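/- There exists a constant c such that for every labeled caterpillar tree T with n ≥ 1 edges, whose edges are labeled by strings of length at most ℓ over a weighted alphabet Γ, there is a contracting SLP over Γ defining all nonempty prefixes in T that has at most c·n variables and right-hand sides of length at most c·ℓ. -/

import Mathlib

/-- A straight-line program: every variable has exactly one rule `rhs A`,
and a ranking witnesses acyclicity (variables on right-hand sides have
smaller rank), so every variable derives a unique string `val A`. -/
structure SLP (V : Type) (Γ : Type) where
  rhs : V → List (V ⊕ Γ)
  rank : V → ℕ
  rank_lt : ∀ A B, Sum.inl B ∈ rhs A → rank B < rank A
  start : V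

namespace SLP

variable {V Γ : Type}

/-- The string derived by a variable. -/
def val (G : SLP V Γ) (A : V) : List Γ :=
  ((G.rhs A).attach.map (fun β =>
    match β with
    | ⟨Sum.inl B, _⟩ => G.val B
    | ⟨Sum.inr a, _⟩ => [a])).flatten
termination_by G.rank A
decreasing_by exact G.rank_lt _ _ (by assumption)

/-- A string is defined by the SLP if some variable derives it. -/
def defines (G : SLP V Γ) (s : List Γ) : Prop := ∃ A, G.val A = s

/-- The size of an SLP: total length of all right-hand sides. -/
def size [Fintype V] (G : SLP V Γ) : ℕ := ∑ A : V, (G.rhs A).length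

end SLP

/-- Weight of a string over a weighted alphabet. -/
def wstr {Γ : Type} (w : Γ → ℕ) (s : List Γ) : ℕ := (s.map w).sum

namespace SLP

variable {V Γ : Type}

/-- Weight of the string derived by a variable. -/
def wval (G : SLP V Γ) (w : Γ → ℕ) (A : V) : ℕ := wstr w (G.val A)

/-- Weight of a symbol (variable or terminal). -/
def symWeight (G : SLP V Γ) (w : Γ → ℕ) : V ⊕ Γ → ℕ
  | Sum.inl B => G.wval w B
  | Sum.inr a => w a

/-- An SLP is contracting (w.r.t. the weight `w`) if every variable `B` on the
right-hand side of a rule of `A` satisfies `‖B‖ ≤ ‖A‖/2`. -/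
def Contracting (G : SLP V Γ) (w : Γ → ℕ) : Prop :=
  ∀ A B, Sum.inl B ∈ G.rhs A → 2 * G.wval w B ≤ G.wval w A

end SLP


/-- A labeled rooted tree: each non-root node `v` has a parent, and the edge from
the parent to `v` is labeled by the string `label v`; a depth function witnesses
well-foundedness of the parent relation. -/
structure LTree (ν Γ : Type) where
  root : ν
  parent : ν → Option ν
  label : ν → List Γ
  depth : ν → ℕ
  parent_eq_none : ∀ v, parent v = none ↔ v = root
  depth_lt : ∀ v u, parent v = some u → depth u < depth v

namespace LTree

variable {ν Γ : Type}

/-- The prefix in `T` at node `v`: the concatenation of the edge labels along the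
path from the root to `v`. -/
def prefixAt (T : LTree ν Γ) (v : ν) : List Γ :=
  match h : T.parent v with
  | none => []
  | some u => T.prefixAt u ++ T.label v
termination_by T.depth v
decreasing_by exact T.depth_lt v u h

/-- A node is a leaf if it has no children. -/
def IsLeaf (T : LTree ν Γ) (v : ν) : Prop := ∀ u, T.parent u ≠ some v

/-- A caterpillar tree: every node has at most one child that is not a leaf. -/
def Caterpillar (T : LTree ν Γ) : Prop :=
  ∀ u v₁ v₂, T.parent v₁ = some u → T.parent v₂ = some u →
    ¬T.IsLeaf v₁ → ¬T.IsLeaf v₂ → v₁ = v₂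

end LTree

namespace IntervalSLP

/-- `r` is reached from `l` by exactly `k` consecutive `R`-steps. -/
def Steps (R : ℕ → ℕ → Prop) : ℕ → ℕ → ℕ → Prop
  | 0, l, r => l = r
  | k + 1, l, r => ∃ m, R l m ∧ Steps R k m r

/-- The interval `(l, r]` may be used in the rule of an interval of weight `B`: it has at most
one letter, or it belongs to `I` and has weight at most `B / 2`. -/
def Part (W : ℕ → ℕ) (I : Finset (ℕ × ℕ)) (B l r : ℕ) : Prop :=
  l ≤ r ∧ (r ≤ l + 1 ∨ (l, r) ∈ I ∧ 2 * (W r - W l) ≤ B)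

/-- Every interval of `I` has a contracting rule with `c` symbols. -/
def Good (W : ℕ → ℕ) (c : ℕ) (I : Finset (ℕ × ℕ)) : Prop :=
  ∀ p ∈ I, Steps (Part W I (W p.2 - W p.1)) c p.1 p.2

/-- The interval `(l, r]` belongs to `I` and has a contracting rule with four symbols. -/
def Nice (W : ℕ → ℕ) (I : Finset (ℕ × ℕ)) (l r : ℕ) : Prop :=
  (l, r) ∈ I ∧ Steps (Part W I (W r - W l)) 4 l r

section Steps

variable {R R' : ℕ → ℕ → Prop} {k k' l m r : ℕ}

theorem Steps.mono (h : ∀ a b, R a b → R' a b) (s : Steps R k l r) : Steps R' k l r := by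
  induction k generalizing l with
  | zero => exact s
  | succ k ih =>
    obtain ⟨m, hm, s⟩ := s
    exact ⟨m, h _ _ hm, ih s⟩

theorem Steps.append (s : Steps R k l m) (s' : Steps R k' m r) : Steps R (k + k') l r := by
  induction k generalizing l with
  | zero =>
    obtain rfl : l = m := s
    simpa using s'
  | succ k ih =>
    obtain ⟨a, ha, s⟩ := s
    rw [Nat.add_right_comm]
    exact ⟨a, ha, ih s⟩

theorem steps_one (h : R l r) : Steps R 1 l r := ⟨r, h, rfl⟩

theorem steps_refl (h : ∀ a, R a a) (k : ℕ) : Steps R k l l := by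
  induction k with
  | zero => rfl
  | succ k ih => exact ⟨l, h l, ih⟩

theorem Steps.pad (h : ∀ a, R a a) (s : Steps R k l r) (hk : k ≤ k') : Steps R k' l r := by
  obtain ⟨j, rfl⟩ := Nat.exists_eq_add_of_le hk
  exact s.append (steps_refl h j)

theorem Steps.le (h : ∀ a b, R a b → a ≤ b) (s : Steps R k l r) : l ≤ r := by
  induction k generalizing l with
  | zero => exact le_of_eq s
  | succ k ih =>
    obtain ⟨m, hm, s⟩ := s
    exact (h _ _ hm).trans (ih s)

theorem Steps.split_at {W : ℕ → ℕ} {t : ℕ} (s : Steps R k l r) (hk : k ≠ 0)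
    (hl : 2 * W l ≤ t) (hr : t ≤ 2 * W r) :
    ∃ i j a b, i + j + 1 = k ∧ Steps R i l a ∧ R a b ∧ Steps R j b r ∧
      2 * W a ≤ t ∧ t ≤ 2 * W b := by
  induction k generalizing l with
  | zero => exact absurd rfl hk
  | succ k ih =>
    obtain ⟨m, hm, s⟩ := s
    by_cases hmt : t ≤ 2 * W m
    · exact ⟨0, k, l, m, by omega, rfl, hm, s, hl, hmt⟩
    · rcases k with _ | k
      · obtain rfl : m = r := s
        exact absurd hr hmt
      · obtain ⟨i, j, a, b, e, h1, h2, h3, h4⟩ := ih s (by omega) (by omega)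
        exact ⟨i + 1, j, a, b, by omega, ⟨m, hm, h1⟩, h2, h3, h4⟩

end Steps

section Good

variable {W : ℕ → ℕ} {I J : Finset (ℕ × ℕ)} {B B' c l r : ℕ}

theorem Part.mono (h : I ⊆ J) (hB : B ≤ B') (p : Part W I B l r) : Part W J B' l r :=
  ⟨p.1, p.2.imp_right fun q => ⟨h q.1, q.2.trans hB⟩⟩

theorem part_refl (a : ℕ) : Part W I B a a := ⟨le_rfl, .inl (by omega)⟩

theorem Part.steps_mono {k : ℕ} (h : I ⊆ J) (hB : B ≤ B') (s : Steps (Part W I B) k l r) :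
    Steps (Part W J B') k l r :=
  s.mono fun _ _ => Part.mono h hB

theorem Part.steps_le {k : ℕ} (s : Steps (Part W I B) k l r) : l ≤ r :=
  s.le fun _ _ h => h.1

theorem Nice.mono (h : I ⊆ J) (p : Nice W I l r) : Nice W J l r :=
  ⟨h p.1, Part.steps_mono h le_rfl p.2⟩

theorem Nice.le (p : Nice W I l r) : l ≤ r := Part.steps_le p.2

theorem part_of_eq_or_mem (h : l = r ∨ (l, r) ∈ I) (hlr : l ≤ r)
    (hB : 2 * (W r - W l) ≤ B) : Part W I B l r :=
  ⟨hlr, h.imp (by omega) fun h => ⟨h, hB⟩⟩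

theorem Good.insert (hI : Good W c I) (s : Steps (Part W I (W r - W l)) c l r) :
    Good W c (insert (l, r) I) := by
  intro p hp
  refine Part.steps_mono (Finset.subset_insert _ _) le_rfl ?_
  rcases Finset.mem_insert.1 hp with rfl | hp
  · exact s
  · exact hI p hp

/-- A concatenation of `k` nice intervals can be defined using `k` further intervals. -/
theorem exists_good_of_steps_nice (hW : Monotone W) (k : ℕ) :
    ∀ {J : Finset (ℕ × ℕ)} {l r : ℕ}, Good W 6 J → Steps (Nice W J) k l r →
      ∃ J', J ⊆ J' ∧ Good W 6 J' ∧ (l = r ∨ (l, r) ∈ J') ∧ J'.card ≤ J.card + k := by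
  induction k using Nat.strong_induction_on with
  | _ k ih =>
  intro J l r hJ s
  rcases Nat.eq_zero_or_pos k with rfl | hk
  · exact ⟨J, subset_rfl, hJ, .inl s, le_rfl⟩
  have hlr : l ≤ r := s.le fun _ _ h => h.le
  have hWlr := hW hlr
  obtain ⟨i, j, a, b, e, s1, hab, s2, ha, hb⟩ :=
    s.split_at (W := W) (t := W l + W r) hk.ne' (by omega) (by omega)
  have hla := s1.le fun _ _ h => h.le
  have hbr := s2.le fun _ _ h => h.le
  have h1 := hW hla
  have h2 := hW hbr
  have h3 := hW hab.le
  obtain ⟨J₁, hJ₁, g₁, m₁, c₁⟩ := ih i (by omega) hJ s1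
  obtain ⟨J₂, hJ₂, g₂, m₂, c₂⟩ := ih j (by omega) g₁ (s2.mono fun _ _ => Nice.mono hJ₁)
  have hJJ₂ := hJ₁.trans hJ₂
  refine ⟨insert (l, r) J₂, hJJ₂.trans (Finset.subset_insert _ _), g₂.insert ?_,
    .inr (Finset.mem_insert_self _ _), (Finset.card_insert_le _ _).trans (by omega)⟩
  have p1 : Part W J₂ (W r - W l) l a :=
    part_of_eq_or_mem (m₁.imp_right fun h => hJ₂ h) hla (by omega)
  have p2 : Part W J₂ (W r - W l) b r := part_of_eq_or_mem m₂ hbr (by omega)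
  have p3 : Steps (Part W J₂ (W r - W l)) 4 a b := Part.steps_mono hJJ₂ (by omega) hab.2
  exact ((steps_one p1).append p3).append (steps_one p2)

theorem exists_good_family {ι : Type*} {P : Finset (ℕ × ℕ) → ι → Prop}
    (hP : ∀ i J J', J ⊆ J' → P J i → P J' i) {cost : ι → ℕ} (hI : Good W c I) (F : Finset ι)
    (h : ∀ i ∈ F, ∀ J, I ⊆ J → Good W c J →
      ∃ J', J ⊆ J' ∧ Good W c J' ∧ P J' i ∧ J'.card ≤ J.card + cost i) :
    ∃ J, I ⊆ J ∧ Good W c J ∧ (∀ i ∈ F, P J i) ∧ J.card ≤ I.card + ∑ i ∈ F, cost i := by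
  classical
  induction F using Finset.induction_on with
  | empty => exact ⟨I, subset_rfl, hI, by simp, by simp⟩
  | insert a F ha ih =>
    obtain ⟨J, hIJ, gJ, pJ, cJ⟩ := ih fun i hi => h i (Finset.mem_insert_of_mem hi)
    obtain ⟨J', hJJ', gJ', pJ', cJ'⟩ := h a (Finset.mem_insert_self _ _) J hIJ gJ
    refine ⟨J', hIJ.trans hJJ', gJ', ?_, ?_⟩
    · intro i hi
      rcases Finset.mem_insert.1 hi with rfl | hi
      · exact pJ'
      · exact hP _ _ _ hJJ' (pJ i hi)
    · rw [Finset.sum_insert ha]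
      omega

end Good

section Blocks

variable {W : ℕ → ℕ} {J : Finset (ℕ × ℕ)} {N : ℕ}

/-- All dyadic intervals of `(0, 2 ^ N]` of length less than `2 ^ d` are nice. -/
def NiceBlocks (W : ℕ → ℕ) (N d : ℕ) (J : Finset (ℕ × ℕ)) : Prop :=
  ∀ e < d, ∀ j, (j + 1) * 2 ^ e ≤ 2 ^ N → Nice W J (j * 2 ^ e) ((j + 1) * 2 ^ e)

theorem NiceBlocks.mono {J' : Finset (ℕ × ℕ)} {d : ℕ} (h : J ⊆ J') (b : NiceBlocks W N d J) :
    NiceBlocks W N d J' := fun e he j hj => (b e he j hj).mono h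

/-- A dyadic interval of length `2 ^ d` consists of a core with two symbols
carrying half of the weight, surrounded by at most `d` smaller dyadic intervals. -/
theorem exists_core (B d : ℕ) : ∀ j, (j + 1) * 2 ^ d ≤ 2 ^ N → NiceBlocks W N d J →
    B ≤ 2 * (W ((j + 1) * 2 ^ d) - W (j * 2 ^ d)) →
    ∃ u v k k', k + k' ≤ d ∧ Steps (Nice W J) k (j * 2 ^ d) u ∧
      Steps (Nice W J) k' v ((j + 1) * 2 ^ d) ∧ B ≤ 2 * (W v - W u) ∧
      Steps (Part W J B) 2 u v := by
  induction d with
  | zero =>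
    intro j _ _ hB
    exact ⟨_, _, 0, 0, le_rfl, rfl, rfl, hB, _, ⟨by omega, .inl (by omega)⟩,
      steps_one (part_refl _)⟩
  | succ d ih =>
    intro j hj hJ hB
    have e1 : j * 2 ^ (d + 1) = (2 * j) * 2 ^ d := by ring
    have e2 : (j + 1) * 2 ^ (d + 1) = (2 * j + 1 + 1) * 2 ^ d := by ring
    have e3 : (2 * j + 1) * 2 ^ d ≤ (2 * j + 1 + 1) * 2 ^ d := by gcongr; omega
    rw [e2] at hj
    rw [e1, e2] at hB ⊢
    have n1 := hJ d (by omega) (2 * j) (by omega)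
    have n2 := hJ d (by omega) (2 * j + 1) hj
    have hJ' : NiceBlocks W N d J := fun e he => hJ e (by omega)
    by_cases h1 : B < 2 * (W ((2 * j + 1) * 2 ^ d) - W (2 * j * 2 ^ d))
    · obtain ⟨u, v, k, k', hk, s1, s2, hc, s3⟩ := ih (2 * j) (by omega) hJ' (by omega)
      exact ⟨u, v, k, k' + 1, by omega, s1, s2.append (steps_one n2), hc, s3⟩
    by_cases h2 : B < 2 * (W ((2 * j + 1 + 1) * 2 ^ d) - W ((2 * j + 1) * 2 ^ d))
    · obtain ⟨u, v, k, k', hk, s1, s2, hc, s3⟩ := ih (2 * j + 1) hj hJ' (by omega)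
      refine ⟨u, v, 1 + k, k', by omega, (steps_one n1).append s1, s2, hc, s3⟩
    · exact ⟨_, _, 0, 0, by omega, rfl, rfl, hB, _, ⟨n1.le, .inr ⟨n1.1, by omega⟩⟩,
        steps_one ⟨n2.le, .inr ⟨n2.1, by omega⟩⟩⟩

theorem exists_good_block (hW : Monotone W) {d j : ℕ} (hj : (j + 1) * 2 ^ d ≤ 2 ^ N)
    (hJ : NiceBlocks W N d J) (g : Good W 6 J) :
    ∃ J', J ⊆ J' ∧ Good W 6 J' ∧ Nice W J' (j * 2 ^ d) ((j + 1) * 2 ^ d) ∧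
      J'.card ≤ J.card + (d + 1) := by
  set l := j * 2 ^ d with hl
  set r := (j + 1) * 2 ^ d with hr
  obtain ⟨u, v, k, k', hk, s1, s2, hc, s3⟩ :=
    exists_core (W := W) (J := J) (W r - W l) d j hj hJ (Nat.le_mul_of_pos_left _ two_pos)
  have hlu : l ≤ u := s1.le fun _ _ h => h.le
  have hvr : v ≤ r := s2.le fun _ _ h => h.le
  have huv := Part.steps_le s3
  have h1 := hW hlu
  have h2 := hW hvr
  have h3 := hW huv
  obtain ⟨J₁, hJ₁, g₁, m₁, c₁⟩ := exists_good_of_steps_nice hW k g s1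
  obtain ⟨J₂, hJ₂, g₂, m₂, c₂⟩ :=
    exists_good_of_steps_nice hW k' g₁ (s2.mono fun _ _ => Nice.mono hJ₁)
  have hJJ₂ := hJ₁.trans hJ₂
  have p1 : Part W J₂ (W r - W l) l u :=
    part_of_eq_or_mem (m₁.imp_right fun h => hJ₂ h) hlu (by omega)
  have p2 : Part W J₂ (W r - W l) v r := part_of_eq_or_mem m₂ hvr (by omega)
  have s : Steps (Part W J₂ (W r - W l)) 4 l r :=
    ((steps_one p1).append (Part.steps_mono hJJ₂ le_rfl s3)).append (steps_one p2)
  have hins := Finset.subset_insert (l, r) J₂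
  exact ⟨insert (l, r) J₂, hJJ₂.trans hins, g₂.insert (s.pad part_refl (by omega)),
    ⟨Finset.mem_insert_self _ _, Part.steps_mono hins le_rfl s⟩,
    (Finset.card_insert_le _ _).trans (by omega)⟩

theorem exists_niceBlocks (hW : Monotone W) (N d : ℕ) (hd : d ≤ N) :
    ∃ J, Good W 6 J ∧ NiceBlocks W N (d + 1) J ∧
      J.card + 2 ^ (N - d) * (d + 3) ≤ 4 * 2 ^ N := by
  induction d with
  | zero =>
    refine ⟨(Finset.range (2 ^ N)).image fun j => (j, j + 1), ?_, ?_, ?_⟩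
    · intro p hp
      obtain ⟨j, -, rfl⟩ := Finset.mem_image.1 hp
      exact (steps_one ⟨by simp, .inl le_rfl⟩).pad part_refl (by omega)
    · intro e he j hj
      obtain rfl : e = 0 := by omega
      simp only [pow_zero, mul_one] at hj ⊢
      exact ⟨Finset.mem_image.2 ⟨j, Finset.mem_range.2 hj, rfl⟩,
        (steps_one ⟨by simp, .inl le_rfl⟩).pad part_refl (by omega)⟩
    · have := Finset.card_image_le (s := Finset.range (2 ^ N)) (f := fun j => (j, j + 1))
      rw [Finset.card_range] at this
      simp only [Nat.sub_zero, zero_add]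
      omega
  | succ d ih =>
    obtain ⟨I, gI, bI, cI⟩ := ih (by omega)
    obtain ⟨J, hIJ, gJ, pJ, cJ⟩ := exists_good_family (c := 6)
      (P := fun J j => Nice W J (j * 2 ^ (d + 1)) ((j + 1) * 2 ^ (d + 1)))
      (fun _ _ _ h => Nice.mono h) (cost := fun _ => d + 2) gI (Finset.range (2 ^ (N - (d + 1))))
      fun j hj J hJ g => exists_good_block hW (by
        calc (j + 1) * 2 ^ (d + 1) ≤ 2 ^ (N - (d + 1)) * 2 ^ (d + 1) := by
              gcongr; exact Finset.mem_range.1 hj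
          _ = 2 ^ N := by rw [← pow_add]; congr 1; omega) (bI.mono hJ) g
    refine ⟨J, gJ, ?_, ?_⟩
    · intro e he j hj
      rcases Nat.lt_succ_iff_lt_or_eq.1 he with he | rfl
      · exact (bI e he j hj).mono hIJ
      · refine pJ j (Finset.mem_range.2 ?_)
        have : (j + 1) * 2 ^ (d + 1) ≤ 2 ^ (N - (d + 1)) * 2 ^ (d + 1) := by
          rw [← pow_add, Nat.sub_add_cancel hd]; exact hj
        exact Nat.le_of_mul_le_mul_right this (by positivity)
    · have e : 2 ^ (N - d) = 2 * 2 ^ (N - (d + 1)) := by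
        rw [← pow_succ']; congr 1; omega
      simp only [Finset.sum_const, Finset.card_range, smul_eq_mul] at cJ
      rw [e] at cI
      nlinarith

theorem steps_suffix {D : ℕ} (hJ : NiceBlocks W N D J) : ∀ d < D, ∀ j l,
    (j + 1) * 2 ^ d ≤ 2 ^ N → j * 2 ^ d ≤ l → l ≤ (j + 1) * 2 ^ d →
    ∃ k ≤ d + 1, Steps (Nice W J) k l ((j + 1) * 2 ^ d) := by
  intro d
  induction d with
  | zero =>
    intro hd j l hj h1 h2
    rcases h1.eq_or_lt with rfl | h1
    · exact ⟨1, by omega, steps_one (hJ 0 hd j hj)⟩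
    · exact ⟨0, by omega, show l = _ by omega⟩
  | succ d ih =>
    intro hd j l hj h1 h2
    have e1 : j * 2 ^ (d + 1) = (2 * j) * 2 ^ d := by ring
    have e2 : (j + 1) * 2 ^ (d + 1) = (2 * j + 1 + 1) * 2 ^ d := by ring
    have e3 : (2 * j + 1) * 2 ^ d ≤ (2 * j + 1 + 1) * 2 ^ d := by gcongr; omega
    rw [e1] at h1
    rw [e2] at hj h2 ⊢
    by_cases hl : l ≤ (2 * j + 1) * 2 ^ d
    · obtain ⟨k, hk, s⟩ := ih (by omega) (2 * j) l (by omega) h1 hl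
      exact ⟨k + 1, by omega, s.append (steps_one (hJ d (by omega) _ hj))⟩
    · obtain ⟨k, hk, s⟩ := ih (by omega) (2 * j + 1) l hj (by omega) h2
      exact ⟨k, by omega, s⟩

theorem steps_prefix {D : ℕ} (hJ : NiceBlocks W N D J) : ∀ d < D, ∀ j r,
    (j + 1) * 2 ^ d ≤ 2 ^ N → j * 2 ^ d ≤ r → r ≤ (j + 1) * 2 ^ d →
    ∃ k ≤ d + 1, Steps (Nice W J) k (j * 2 ^ d) r := by
  intro d
  induction d with
  | zero =>
    intro hd j r hj h1 h2
    rcases h2.eq_or_lt with rfl | h2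
    · exact ⟨1, by omega, steps_one (hJ 0 hd j hj)⟩
    · exact ⟨0, by omega, show _ = r by omega⟩
  | succ d ih =>
    intro hd j r hj h1 h2
    have e1 : j * 2 ^ (d + 1) = (2 * j) * 2 ^ d := by ring
    have e2 : (j + 1) * 2 ^ (d + 1) = (2 * j + 1 + 1) * 2 ^ d := by ring
    have e3 : (2 * j + 1) * 2 ^ d ≤ (2 * j + 1 + 1) * 2 ^ d := by gcongr; omega
    rw [e1] at h1 ⊢
    rw [e2] at hj h2
    by_cases hl : r ≤ (2 * j + 1) * 2 ^ d
    · obtain ⟨k, hk, s⟩ := ih (by omega) (2 * j) r (by omega) h1 hl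
      exact ⟨k, by omega, s⟩
    · obtain ⟨k, hk, s⟩ := ih (by omega) (2 * j + 1) r hj (by omega) h2
      exact ⟨1 + k, by omega, (steps_one (hJ d (by omega) _ (by omega))).append s⟩

theorem steps_subinterval {D : ℕ} (hJ : NiceBlocks W N D J) : ∀ d < D, ∀ j l r,
    (j + 1) * 2 ^ d ≤ 2 ^ N → j * 2 ^ d ≤ l → l ≤ r → r ≤ (j + 1) * 2 ^ d →
    ∃ k ≤ 2 * d + 2, Steps (Nice W J) k l r := by
  intro d
  induction d with
  | zero =>
    intro hd j l r hj h1 h2 h3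
    rcases h1.eq_or_lt with rfl | h1
    · obtain ⟨k, hk, s⟩ := steps_prefix hJ 0 hd j r hj h2 h3
      exact ⟨k, by omega, s⟩
    · exact ⟨0, by omega, show l = r by omega⟩
  | succ d ih =>
    intro hd j l r hj h1 h2 h3
    have e1 : j * 2 ^ (d + 1) = (2 * j) * 2 ^ d := by ring
    have e2 : (j + 1) * 2 ^ (d + 1) = (2 * j + 1 + 1) * 2 ^ d := by ring
    have e3 : (2 * j + 1) * 2 ^ d ≤ (2 * j + 1 + 1) * 2 ^ d := by gcongr; omega
    rw [e1] at h1
    rw [e2] at hj h3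
    by_cases hr : r ≤ (2 * j + 1) * 2 ^ d
    · obtain ⟨k, hk, s⟩ := ih (by omega) (2 * j) l r (by omega) h1 h2 hr
      exact ⟨k, by omega, s⟩
    by_cases hl : (2 * j + 1) * 2 ^ d ≤ l
    · obtain ⟨k, hk, s⟩ := ih (by omega) (2 * j + 1) l r hj hl h2 h3
      exact ⟨k, by omega, s⟩
    obtain ⟨k, hk, s⟩ := steps_suffix hJ d (by omega) (2 * j) l (by omega) h1 (by omega)
    obtain ⟨k', hk', s'⟩ := steps_prefix hJ d (by omega) (2 * j + 1) r hj (by omega) h3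
    exact ⟨k + k', by omega, s.append s'⟩

end Blocks

section Start

variable {W : ℕ → ℕ} {b x y t : ℕ}

/-- The first position `i` such that `(b, i]` has binary logarithmic weight equal to that
of `(b, x]`. -/
noncomputable def next (W : ℕ → ℕ) (b x : ℕ) : ℕ :=
  sInf {i | b ≤ i ∧ (2 ^ Nat.log 2 (W x - W b) ≤ W i - W b ∨ x ≤ i)}

/-- The left endpoint of the tail of `(0, x]` that is defined at level `t`. -/
noncomputable def start (W : ℕ → ℕ) : ℕ → ℕ → ℕ
  | 0, _ => 0
  | t + 1, x => next W (start W t x) x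

theorem next_mem (h : b ≤ x) :
    b ≤ next W b x ∧ (2 ^ Nat.log 2 (W x - W b) ≤ W (next W b x) - W b ∨ x ≤ next W b x) :=
  Nat.sInf_mem (s := {i | b ≤ i ∧ (2 ^ Nat.log 2 (W x - W b) ≤ W i - W b ∨ x ≤ i)})
    ⟨x, h, .inr le_rfl⟩

theorem next_le_of {i : ℕ} (h : b ≤ i) (hi : 2 ^ Nat.log 2 (W x - W b) ≤ W i - W b ∨ x ≤ i) :
    next W b x ≤ i :=
  Nat.sInf_le (s := {i | b ≤ i ∧ (2 ^ Nat.log 2 (W x - W b) ≤ W i - W b ∨ x ≤ i)}) ⟨h, hi⟩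

theorem next_le (h : b ≤ x) : next W b x ≤ x := next_le_of h (.inr le_rfl)

theorem pow_log_le_next (h : b ≤ x) (hlt : W b < W x) :
    2 ^ Nat.log 2 (W x - W b) ≤ W (next W b x) - W b := by
  rcases (next_mem (W := W) h).2 with h1 | h1
  · exact h1
  · rw [le_antisymm (next_le h) h1]
    exact Nat.pow_log_le_self 2 (by omega)

theorem lt_next (h : b ≤ x) (hlt : W b < W x) : b < next W b x := by
  refine lt_of_le_of_ne (next_mem h).1 fun e => ?_
  have := pow_log_le_next h hlt
  rw [← e, Nat.sub_self] at this
  exact absurd this (by simp)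

theorem weight_pred_next (h : b ≤ x) (hlt : W b < W x) :
    W (next W b x - 1) - W b < 2 ^ Nat.log 2 (W x - W b) := by
  have := lt_next h hlt
  by_contra hc
  have := next_le_of (W := W) (b := b) (x := x) (i := next W b x - 1) (by omega)
    (.inl (not_lt.1 hc))
  omega

theorem next_eq_of_le (hW : Monotone W) (h : b ≤ x) (hy : next W b x ≤ y) (hyx : y ≤ x) :
    next W b y = next W b x := by
  have hb := (next_mem (W := W) h).1
  by_cases hlt : W b < W x
  · have h1 := pow_log_le_next h hlt
    have h2 := hW hy
    have h3 := hW hyx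
    have hlog : Nat.log 2 (W y - W b) = Nat.log 2 (W x - W b) := by
      refine le_antisymm (Nat.log_mono_right (by omega)) ?_
      exact Nat.le_log_of_pow_le one_lt_two (by omega)
    apply le_antisymm
    · exact next_le_of hb (.inl (hlog ▸ h1))
    · obtain ⟨h4, h5⟩ := next_mem (W := W) (b := b) (x := y) (by omega)
      refine next_le_of h4 (.inl ?_)
      rcases h5 with h5 | h5
      · exact hlog ▸ h5
      · have := hW h5
        omega
  · have hx : x ≤ next W b x := by
      rcases (next_mem (W := W) h).2 with h1 | h1
      · have h2 := hW (next_le (W := W) h)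
        have h3 : 0 < 2 ^ Nat.log 2 (W x - W b) := by positivity
        omega
      · exact h1
    rw [show y = x by omega]

theorem start_le (W : ℕ → ℕ) (t x : ℕ) : start W t x ≤ x := by
  induction t with
  | zero => exact Nat.zero_le _
  | succ t ih => exact next_le ih

theorem start_le_succ (W : ℕ → ℕ) (t x : ℕ) : start W t x ≤ start W (t + 1) x :=
  (next_mem (start_le W t x)).1

theorem start_eq_of_le (hW : Monotone W) (t : ℕ) :
    ∀ {x y : ℕ}, start W t x ≤ y → y ≤ x → start W t y = start W t x := by
  induction t with
  | zero => intros; rfl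
  | succ t ih =>
    intro x y h1 h2
    have e := ih ((start_le_succ W t x).trans h1) h2
    simp only [start] at h1 ⊢
    rw [e]
    exact next_eq_of_le hW (start_le W t x) h1 h2

end Start

section Main

variable {W : ℕ → ℕ} {I J : Finset (ℕ × ℕ)} {N t x : ℕ}

/-- The largest multiple of `2 ^ t` that is at most `x`. -/
def roundDown (t x : ℕ) : ℕ := x / 2 ^ t * 2 ^ t

theorem roundDown_le (t x : ℕ) : roundDown t x ≤ x := Nat.div_mul_le_self _ _

theorem dvd_roundDown (t x : ℕ) : 2 ^ t ∣ roundDown t x := Dvd.intro_left _ rfl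

theorem succ_div_mul_le (ht : t ≤ N) (hx : x < 2 ^ N) : (x / 2 ^ t + 1) * 2 ^ t ≤ 2 ^ N := by
  obtain ⟨k, rfl⟩ := Nat.exists_eq_add_of_le ht
  rw [pow_add, mul_comm (2 ^ t)] at hx ⊢
  have := (Nat.div_lt_iff_lt_mul (by positivity)).2 hx
  gcongr
  omega

/-- The two connecting intervals in the rule of `(start W t x, x]` are empty or in `J`. -/
def HasLinks (W : ℕ → ℕ) (t x : ℕ) (J : Finset (ℕ × ℕ)) : Prop :=
  W (start W t x) < W x →
    (let i := start W (t + 1) x - 1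
     max (start W t x) (roundDown t i) = i ∨ (max (start W t x) (roundDown t i), i) ∈ J) ∧
    (let q := max (start W (t + 1) x) (roundDown (t + 1) x)
     q = x ∨ (q, x) ∈ J)

theorem exists_good_hasLinks (hW : Monotone W) (hJ : NiceBlocks W N (N + 1) J) (g : Good W 6 J)
    (ht : t ≤ N) (hx : x < 2 ^ N) (hdvd : 2 ^ t ∣ x) :
    ∃ J', J ⊆ J' ∧ Good W 6 J' ∧ HasLinks W t x J' ∧ J'.card ≤ J.card + 3 * (t + 1) := by
  by_cases hlt : W (start W t x) < W x
  swap
  · exact ⟨J, subset_rfl, g, fun h => absurd h hlt, by omega⟩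
  have hb : start W t x < start W (t + 1) x := lt_next (start_le W t x) hlt
  have hb' := start_le W (t + 1) x
  obtain ⟨i, hi⟩ : ∃ i, i = start W (t + 1) x - 1 := ⟨_, rfl⟩
  obtain ⟨k₁, hk₁, s₁⟩ := steps_subinterval hJ t (by omega) (i / 2 ^ t)
    (max (start W t x) (roundDown t i)) i (succ_div_mul_le ht (by omega)) (le_max_right _ _)
    (max_le (by omega) (roundDown_le t i))
    (Nat.lt_mul_of_div_lt (Nat.lt_succ_self _) (by positivity)).le
  obtain ⟨J₁, hJ₁, g₁, m₁, c₁⟩ := exists_good_of_steps_nice hW k₁ g s₁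
  obtain ⟨k₂, hk₂, s₂⟩ : ∃ k ≤ t + 1, Steps (Nice W J) k
      (max (start W (t + 1) x) (roundDown (t + 1) x)) x := by
    obtain ⟨j, rfl⟩ := hdvd
    rw [mul_comm] at *
    rcases Nat.even_or_odd' j with ⟨m, rfl | rfl⟩
    · refine ⟨0, by omega, ?_⟩
      have : roundDown (t + 1) (2 * m * 2 ^ t) = 2 * m * 2 ^ t := by
        rw [roundDown, show 2 * m * 2 ^ t = m * 2 ^ (t + 1) by ring,
          Nat.mul_div_cancel _ (by positivity)]
      rw [this]
      exact max_eq_right hb'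
    · refine steps_suffix hJ t (by omega) (2 * m) _ hx.le (le_max_of_le_right ?_)
        (max_le hb' (roundDown_le _ _))
      rw [roundDown, show 2 * m * 2 ^ t = m * 2 ^ (t + 1) by ring]
      gcongr
      rw [Nat.le_div_iff_mul_le (by positivity), pow_succ]
      nlinarith [Nat.zero_le (2 ^ t)]
  obtain ⟨J₂, hJ₂, g₂, m₂, c₂⟩ :=
    exists_good_of_steps_nice hW k₂ g₁ (s₂.mono fun _ _ => Nice.mono hJ₁)
  refine ⟨J₂, hJ₁.trans hJ₂, g₂, fun _ => ⟨?_, m₂⟩, by omega⟩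
  rw [← hi]
  exact m₁.imp_right fun h => hJ₂ h

theorem HasLinks.mono (h : I ⊆ J) (hI : HasLinks W t x I) : HasLinks W t x J :=
  fun hlt => (hI hlt).imp (Or.imp_right fun m => h m) (Or.imp_right fun m => h m)

/-- `I` contains all intervals `(start W t x, x]` where `x < 2 ^ N` is a multiple of `2 ^ t`. -/
def HasTails (W : ℕ → ℕ) (N : ℕ) (I : Finset (ℕ × ℕ)) : Prop :=
  ∀ t ≤ N, ∀ x < 2 ^ N, 2 ^ t ∣ x → (start W t x, x) ∈ I

theorem exists_lighter_tail (hW : Monotone W) (hJI : J ⊆ I) (hJ : Good W 6 J)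
    (hI : HasTails W N I) (ht : t ≤ N) (hx : x < 2 ^ N) (hdvd : 2 ^ t ∣ x)
    (hlink : HasLinks W t x J) (hlt : W (start W t x) < W x) :
    ∃ y, start W t x ≤ y ∧ y ≤ x ∧ (y = start W t x ∨ 2 ^ t ∣ y) ∧
      W y - W (start W t x) < 2 ^ Nat.log 2 (W x - W (start W t x)) ∧
      Steps (Part W I (W x - W (start W t x))) 9 y x := by
  have htN : t + 1 ≤ N := by
    refine Nat.lt_of_le_of_ne ht ?_
    rintro rfl
    obtain rfl : x = 0 := Nat.eq_zero_of_dvd_of_lt hdvd hx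
    have := start_le W t 0
    rw [show start W t 0 = 0 by omega] at hlt
    exact absurd hlt (lt_irrefl _)
  have hb := start_le W t x
  have hbb : start W t x < start W (t + 1) x := lt_next hb hlt
  have hbx := start_le W (t + 1) x
  have hw1 : 2 ^ Nat.log 2 (W x - W (start W t x)) ≤ W (start W (t + 1) x) - W (start W t x) :=
    pow_log_le_next hb hlt
  have hw2 : W (start W (t + 1) x - 1) - W (start W t x) <
    2 ^ Nat.log 2 (W x - W (start W t x)) := weight_pred_next hb hlt
  have hw3 : W x - W (start W t x) < 2 ^ (Nat.log 2 (W x - W (start W t x)) + 1) :=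
    Nat.lt_pow_succ_log_self one_lt_two _
  rw [pow_succ] at hw3
  obtain ⟨l1, l2⟩ := hlink hlt
  have hpq : start W (t + 1) x ≤ roundDown (t + 1) x →
      (start W (t + 1) x, roundDown (t + 1) x) ∈ I := by
    intro h
    have hr := roundDown_le (t + 1) x
    rw [← start_eq_of_le hW (t + 1) h hr]
    exact hI _ htN _ (by omega) (dvd_roundDown _ _)
  generalize hB : start W (t + 1) x = b' at *
  generalize start W t x = b at *
  generalize 2 ^ Nat.log 2 (W x - W b) = K at *
  obtain ⟨i, rfl⟩ : ∃ i, b' = i + 1 := ⟨b' - 1, by omega⟩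
  simp only [Nat.add_sub_cancel] at *
  have hyi : max b (roundDown t i) ≤ i := max_le (by omega) (roundDown_le t i)
  have hqx : max (i + 1) (roundDown (t + 1) x) ≤ x := max_le hbx (roundDown_le _ _)
  have m1 := hW hyi
  have m2 := hW (show i ≤ i + 1 by omega)
  have m3 := hW hbx
  have m4 := hW (show b ≤ max b (roundDown t i) from le_max_left _ _)
  have m5 := hW hqx
  have m6 := hW (show i + 1 ≤ max (i + 1) (roundDown (t + 1) x) from le_max_left _ _)
  refine ⟨max b (roundDown t i), le_max_left _ _, by omega, ?_, by omega, ?_⟩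
  · rcases max_choice b (roundDown t i) with h | h
    · exact .inl h
    · exact .inr (by rw [h]; exact dvd_roundDown _ _)
  have s1 : Steps (Part W I (W x - W b)) 6 (max b (roundDown t i)) i := by
    rcases l1 with l1 | l1
    · rw [l1]
      exact steps_refl part_refl _
    · exact Part.steps_mono hJI (by simp only; omega) (hJ _ l1)
  have s2 : Part W I (W x - W b) i (i + 1) := ⟨by omega, .inl le_rfl⟩
  have s3 : Part W I (W x - W b) (i + 1) (max (i + 1) (roundDown (t + 1) x)) := by
    refine part_of_eq_or_mem ?_ (le_max_left _ _) (by omega)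
    rcases le_total (i + 1) (roundDown (t + 1) x) with h | h
    · rw [max_eq_right h]
      exact .inr (hpq h)
    · exact .inl (max_eq_left h).symm
  have s4 : Part W I (W x - W b) (max (i + 1) (roundDown (t + 1) x)) x :=
    part_of_eq_or_mem (l2.imp_right fun h => hJI h) hqx (by omega)
  exact ((s1.append (steps_one s2)).append (steps_one s3)).append (steps_one s4)

theorem steps_tail (hW : Monotone W) (hJI : J ⊆ I) (hJ : Good W 6 J) (hI : HasTails W N I)
    (hlink : ∀ t ≤ N, ∀ x < 2 ^ N, 2 ^ t ∣ x → HasLinks W t x J)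
    (ht : t ≤ N) (hx : x < 2 ^ N) (hdvd : 2 ^ t ∣ x) :
    Steps (Part W I (W x - W (start W t x))) 19 (start W t x) x := by
  have hb := start_le W t x
  by_cases hlt : W (start W t x) < W x
  swap
  · exact (steps_one (part_of_eq_or_mem (.inr (hI t ht x hx hdvd)) hb (by omega))).pad
      part_refl (by omega)
  obtain ⟨y, hby, hyx, hy, hwy, s⟩ :=
    exists_lighter_tail hW hJI hJ hI ht hx hdvd (hlink t ht x hx hdvd) hlt
  have hK := Nat.pow_log_le_self 2 (show W x - W (start W t x) ≠ 0 by omega)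
  have e := start_eq_of_le hW t hby hyx
  rcases hy with rfl | hy
  · exact s.pad part_refl (by omega)
  by_cases hhalf : 2 * (W y - W (start W t x)) ≤ W x - W (start W t x)
  · have hmem := hI t ht y (by omega) hy
    rw [e] at hmem
    exact ((steps_one (part_of_eq_or_mem (.inr hmem) hby hhalf)).append s).pad part_refl (by omega)
  have hlt' : W (start W t y) < W y := by rw [e]; omega
  obtain ⟨z, hbz, hzy, hz, hwz, s'⟩ :=
    exists_lighter_tail hW hJI hJ hI ht (by omega) hy (hlink t ht y (by omega) hy) hlt'
  have e' := start_eq_of_le hW t hbz hzy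
  rw [e] at hbz hz hwz s' e'
  have hWyx := hW hyx
  have hhalf' : 2 * (W z - W (start W t x)) ≤ W x - W (start W t x) := by
    have h1 : Nat.log 2 (W y - W (start W t x)) < Nat.log 2 (W x - W (start W t x)) :=
      Nat.log_lt_of_lt_pow (by omega) hwy
    have h2 := Nat.pow_le_pow_right two_pos h1
    rw [Nat.succ_eq_add_one, pow_succ] at h2
    omega
  have p : Part W I (W x - W (start W t x)) (start W t x) z := by
    refine part_of_eq_or_mem ?_ hbz hhalf'
    refine hz.imp Eq.symm fun h => ?_
    have := hI t ht z (by omega) h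
    rwa [e'] at this
  exact ((steps_one p).append (Part.steps_mono subset_rfl (by omega) s')).append s

theorem sum_pow_mul_succ_le (N : ℕ) :
    ∑ t ∈ Finset.range (N + 1), 2 ^ (N - t) * (t + 1) ≤ 4 * 2 ^ N := by
  have key : ∀ D ≤ N, ∑ t ∈ Finset.range D, 2 ^ (N - t) * (t + 1) + 2 ^ (N - D) * (2 * D + 4) ≤
      4 * 2 ^ N := by
    intro D
    induction D with
    | zero => intro _; simp [mul_comm]
    | succ D ih =>
      intro hD
      have h := ih (by omega)
      have e : 2 ^ (N - D) = 2 * 2 ^ (N - (D + 1)) := by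
        rw [← pow_succ']; congr 1; omega
      rw [Finset.sum_range_succ]
      rw [e] at h ⊢
      nlinarith
  have := key N le_rfl
  rw [Finset.sum_range_succ]
  simp only [Nat.sub_self, pow_zero, one_mul] at this ⊢
  omega

/-- For every weighted string of length `n` there is a family of `O(n)` intervals containing all
prefixes, each of which is composed of at most `19` letters and intervals of the family of at
most half its weight. -/
theorem exists_good_prefixes (hW : Monotone W) {n : ℕ} (hn : 1 ≤ n) :
    ∃ I : Finset (ℕ × ℕ), I.card ≤ 40 * n ∧ Good W 19 I ∧ ∀ i ≤ n, (0, i) ∈ I := by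
  obtain ⟨N, hN, hN'⟩ : ∃ N, n < 2 ^ N ∧ 2 ^ N ≤ 2 * n :=
    ⟨Nat.log 2 n + 1, Nat.lt_pow_succ_log_self one_lt_two n, by
      rw [pow_succ']; exact Nat.mul_le_mul_left 2 (Nat.pow_log_le_self 2 (by omega))⟩
  obtain ⟨J₀, g₀, b₀, c₀⟩ := exists_niceBlocks hW N N le_rfl
  let F : Finset (Σ _ : ℕ, ℕ) :=
    (Finset.range (N + 1)).sigma fun t => Finset.range (2 ^ (N - t))
  have memF : ∀ t j, (⟨t, j⟩ : Σ _ : ℕ, ℕ) ∈ F ↔ t ≤ N ∧ j * 2 ^ t < 2 ^ N := by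
    intro t j
    simp only [F, Finset.mem_sigma, Finset.mem_range, Nat.lt_succ_iff]
    refine and_congr_right fun ht => ?_
    rw [← Nat.mul_lt_mul_right (a := 2 ^ t) (by positivity), ← pow_add, Nat.sub_add_cancel ht]
  obtain ⟨J, hJ, g, hlink, c⟩ := exists_good_family (c := 6)
    (P := fun J p => HasLinks W p.1 (p.2 * 2 ^ p.1) J) (fun _ _ _ h => HasLinks.mono h)
    (cost := fun p => 3 * (p.1 + 1)) g₀ F fun p hp J hJ g =>
      exists_good_hasLinks hW (b₀.mono hJ) g ((memF _ _).1 hp).1 ((memF _ _).1 hp).2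
        (Dvd.intro_left _ rfl)
  let T := F.image fun p => (start W p.1 (p.2 * 2 ^ p.1), p.2 * 2 ^ p.1)
  have hT : HasTails W N (J ∪ T) := by
    rintro t ht x hx ⟨j, rfl⟩
    rw [mul_comm] at hx ⊢
    exact Finset.mem_union_right _ (Finset.mem_image.2 ⟨⟨t, j⟩, (memF t j).2 ⟨ht, hx⟩, rfl⟩)
  have hlink' : ∀ t ≤ N, ∀ x < 2 ^ N, 2 ^ t ∣ x → HasLinks W t x J := by
    rintro t ht x hx ⟨j, rfl⟩
    rw [mul_comm] at hx ⊢
    exact hlink ⟨t, j⟩ ((memF t j).2 ⟨ht, hx⟩)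
  refine ⟨J ∪ T, ?_, ?_, fun i hi => hT 0 (Nat.zero_le _) i (by omega) (one_dvd _)⟩
  · have hS := sum_pow_mul_succ_le N
    have h1 : ∑ p ∈ F, 3 * (p.1 + 1) =
        3 * ∑ t ∈ Finset.range (N + 1), 2 ^ (N - t) * (t + 1) := by
      rw [← Finset.mul_sum, Finset.sum_sigma]
      simp
    have h2 : F.card ≤ ∑ t ∈ Finset.range (N + 1), 2 ^ (N - t) * (t + 1) := by
      rw [Finset.card_sigma]
      refine Finset.sum_le_sum fun t _ => ?_
      rw [Finset.card_range]
      exact Nat.le_mul_of_pos_right _ (Nat.succ_pos _)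
    have h3 : T.card ≤ F.card := Finset.card_image_le
    have h4 := Finset.card_union_le J T
    rw [h1] at c
    omega
  · intro p hp
    rcases Finset.mem_union.1 hp with hp | hp
    · exact (Part.steps_mono Finset.subset_union_left le_rfl (g p hp)).pad part_refl (by omega)
    · obtain ⟨⟨t, j⟩, hF, rfl⟩ := Finset.mem_image.1 hp
      obtain ⟨ht, hx⟩ := (memF t j).1 hF
      exact steps_tail hW Finset.subset_union_left g hT hlink' ht hx (Dvd.intro_left _ rfl)

end Main

end IntervalSLP

section Strings

variable {V ν Γ : Type}

theorem SLP.val_eq_of_rhs (G : SLP V Γ) (f : V → List Γ)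
    (h : ∀ A, ((G.rhs A).map (Sum.elim f fun a => [a])).flatten = f A) (A : V) :
    G.val A = f A := by
  induction hk : G.rank A using Nat.strong_induction_on generalizing A with
  | _ k ih =>
  subst hk
  rw [SLP.val, ← h A]
  conv_rhs => rw [← List.attach_map_subtype_val (G.rhs A), List.map_map]
  congr 1
  refine List.map_congr_left ?_
  rintro ⟨B | a, hB⟩ -
  · exact ih _ (G.rank_lt _ _ hB) B rfl
  · rfl

theorem wstr_append (w : Γ → ℕ) (s t : List Γ) : wstr w (s ++ t) = wstr w s + wstr w t := by
  simp [wstr]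

theorem eq_nil_of_wstr_eq_zero {w : Γ → ℕ} (hw : ∀ a, 0 < w a) {s : List Γ}
    (h : wstr w s = 0) : s = [] := by
  cases s with
  | nil => rfl
  | cons a s =>
    have := hw a
    simp only [wstr, List.map_cons, List.sum_cons] at h
    omega

/-- The concatenation of the strings `s l, …, s (r - 1)`. -/
def infixOf (s : ℕ → List Γ) (l r : ℕ) : List Γ := ((List.Ico l r).map s).flatten

theorem infixOf_append (s : ℕ → List Γ) {l m r : ℕ} (h : l ≤ m) (h' : m ≤ r) :
    infixOf s l m ++ infixOf s m r = infixOf s l r := by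
  rw [infixOf, infixOf, infixOf, ← List.flatten_append, ← List.map_append,
    List.Ico.append_consecutive h h']

theorem infixOf_self (s : ℕ → List Γ) (l : ℕ) : infixOf s l l = [] := by
  simp [infixOf]

theorem infixOf_succ (s : ℕ → List Γ) (l : ℕ) : infixOf s l (l + 1) = s l := by
  simp [infixOf, List.Ico.succ_singleton]

theorem wstr_infixOf (s : ℕ → List Γ) (w : Γ → ℕ) {l r : ℕ} (h : l ≤ r) :
    wstr w (infixOf s l r) = wstr w (infixOf s 0 r) - wstr w (infixOf s 0 l) := by
  rw [← infixOf_append s (Nat.zero_le l) h, wstr_append]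
  omega

open IntervalSLP in
/-- A decomposition of an interval into parts yields a right-hand side. -/
theorem exists_rhs_of_steps {w : Γ → ℕ} (hw : ∀ a, 0 < w a) {s : ℕ → List Γ} {ℓ : ℕ}
    (hℓ : 1 ≤ ℓ) (hs : ∀ i, (s i).length ≤ ℓ) {I : Finset (ℕ × ℕ)} {B k : ℕ} {f : V → List Γ}
    (g : I → V) (hg : ∀ p, f (g p) = infixOf s p.1.1 p.1.2) : ∀ {l r : ℕ},
    Steps (Part (fun i => wstr w (infixOf s 0 i)) I B) k l r →
    ∃ u : List (V ⊕ Γ), (u.map (Sum.elim f fun a => [a])).flatten = infixOf s l r ∧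
      u.length ≤ k * ℓ ∧ ∀ A, Sum.inl A ∈ u → 0 < wstr w (f A) ∧ 2 * wstr w (f A) ≤ B := by
  induction k with
  | zero =>
    rintro l r rfl
    exact ⟨[], by simp [infixOf_self], by simp, by simp⟩
  | succ k ih =>
    rintro l r ⟨m, ⟨hlm, hm⟩, h⟩
    obtain ⟨u, hu, hlen, hA⟩ := ih h
    suffices ∃ u : List (V ⊕ Γ), (u.map (Sum.elim f fun a => [a])).flatten = infixOf s l m ∧
        u.length ≤ ℓ ∧ ∀ A, Sum.inl A ∈ u → 0 < wstr w (f A) ∧ 2 * wstr w (f A) ≤ B by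
      obtain ⟨u', hu', hlen', hA'⟩ := this
      refine ⟨u' ++ u, ?_, ?_, fun A hmem => (List.mem_append.1 hmem).elim (hA' A) (hA A)⟩
      · rw [List.map_append, List.flatten_append, hu, hu', infixOf_append s hlm (Part.steps_le h)]
      · rw [List.length_append, add_mul]
        omega
    rcases Nat.eq_zero_or_pos (wstr w (infixOf s l m)) with h0 | h0
    · exact ⟨[], by simp [eq_nil_of_wstr_eq_zero hw h0], by simp, by simp⟩
    rcases hm with hm | ⟨hmem, hB⟩
    · obtain rfl : m = l + 1 := by
        refine le_antisymm hm (Nat.lt_of_le_of_ne hlm ?_)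
        rintro rfl
        simp [infixOf_self, wstr] at h0
      refine ⟨(s l).map Sum.inr, ?_, by simpa using hs l, by simp⟩
      simp [infixOf_succ, Function.comp_def, ← List.flatMap_def]
    · refine ⟨[Sum.inl (g ⟨_, hmem⟩)], by simp [hg], by simpa using hℓ, fun A h => ?_⟩
      obtain rfl : A = g ⟨_, hmem⟩ := by simpa using h
      rw [hg, wstr_infixOf s w hlm]
      rw [wstr_infixOf s w hlm] at h0
      exact ⟨h0, hB⟩

end Strings

namespace LTree

variable {ν Γ : Type}

/-- The number of edges on the path from the root to a node. -/
def level (T : LTree ν Γ) (v : ν) : ℕ :=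
  match h : T.parent v with
  | none => 0
  | some u => T.level u + 1
termination_by T.depth v
decreasing_by exact T.depth_lt v u h

variable {T : LTree ν Γ} {u v : ν}

theorem level_of_parent (h : T.parent v = some u) : T.level v = T.level u + 1 := by
  rw [level]
  split <;> simp_all

theorem level_root (h : T.parent v = none) : T.level v = 0 := by
  rw [level]
  split <;> simp_all

theorem prefixAt_of_parent (h : T.parent v = some u) :
    T.prefixAt v = T.prefixAt u ++ T.label v := by
  rw [prefixAt]
  split <;> simp_all

theorem prefixAt_root (h : T.parent v = none) : T.prefixAt v = [] := by
  rw [prefixAt]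
  split <;> simp_all

theorem not_isLeaf_of_parent (h : T.parent v = some u) : ¬T.IsLeaf u := fun hu => hu v h

theorem exists_parent_of_level {i : ℕ} (h : T.level v = i + 1) :
    ∃ u, T.parent v = some u ∧ T.level u = i := by
  cases hp : T.parent v with
  | none => simp [level_root hp] at h
  | some u =>
    rw [level_of_parent hp] at h
    exact ⟨u, rfl, by omega⟩

theorem Caterpillar.eq_of_level_eq (hT : T.Caterpillar) {i : ℕ} :
    ∀ {u v : ν}, ¬T.IsLeaf u → ¬T.IsLeaf v → T.level u = i → T.level v = i → u = v := by
  induction i with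
  | zero =>
    intro u v _ _ h h'
    have root : ∀ x, T.level x = 0 → x = T.root := fun x hx => by
      rw [← T.parent_eq_none]
      cases hp : T.parent x with
      | none => rfl
      | some y => simp [level_of_parent hp] at hx
    rw [root u h, root v h']
  | succ i ih =>
    intro u v hu hv h h'
    obtain ⟨x, hx, hxi⟩ := exists_parent_of_level h
    obtain ⟨y, hy, hyi⟩ := exists_parent_of_level h'
    obtain rfl := ih (not_isLeaf_of_parent hx) (not_isLeaf_of_parent hy) hxi hyi
    exact hT x u v hx hy hu hv

theorem exists_level_eq {i k : ℕ} (hi : i ≤ k) : ∀ {v : ν}, T.level v = k →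
    ∃ u, T.level u = i := by
  induction k with
  | zero => intro v hv; exact ⟨v, by omega⟩
  | succ k ih =>
    intro v hv
    rcases hi.eq_or_lt with rfl | hi
    · exact ⟨v, hv⟩
    · obtain ⟨u, -, hu⟩ := exists_parent_of_level hv
      exact ih (by omega) hu

theorem level_lt_card [Fintype ν] (v : ν) : T.level v < Fintype.card ν := by
  classical
  have h : Finset.range (T.level v + 1) ⊆ Finset.univ.image T.level := by
    intro i hi
    obtain ⟨u, hu⟩ := exists_level_eq (T := T) (i := i) (by simpa [Nat.lt_succ_iff] using hi)
      (rfl : T.level v = _)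
    exact Finset.mem_image.2 ⟨u, Finset.mem_univ _, hu⟩
  have h1 := Finset.card_le_card h
  rw [Finset.card_range] at h1
  exact h1.trans Finset.card_image_le

/-- The prefixes in a caterpillar tree are prefixes along its spine extended by at most
one edge label. -/
theorem Caterpillar.exists_spine [Fintype ν] (hT : T.Caterpillar) {ℓ : ℕ}
    (hℓ : ∀ v, v ≠ T.root → (T.label v).length ≤ ℓ) :
    ∃ s : ℕ → List Γ, (∀ i, (s i).length ≤ ℓ) ∧
      ∀ v, ∃ i < Fintype.card ν, ∃ t : List Γ, t.length ≤ ℓ ∧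
        T.prefixAt v = infixOf s 0 i ++ t := by
  classical
  let s : ℕ → List Γ := fun i =>
    if h : ∃ v, ¬T.IsLeaf v ∧ T.level v = i + 1 then T.label h.choose else []
  have hroot : ∀ {v u}, T.parent v = some u → v ≠ T.root := fun h hv => by
    simp [(T.parent_eq_none _).2 hv] at h
  have hspine : ∀ i v, ¬T.IsLeaf v → T.level v = i → T.prefixAt v = infixOf s 0 i := by
    intro i
    induction i with
    | zero =>
      intro v _ hv
      cases hp : T.parent v with
      | none => rw [prefixAt_root hp, infixOf_self]
      | some u => simp [level_of_parent hp] at hv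
    | succ i ih =>
      intro v hv hvi
      obtain ⟨u, hu, hui⟩ := exists_parent_of_level hvi
      have hex : ∃ v, ¬T.IsLeaf v ∧ T.level v = i + 1 := ⟨v, hv, hvi⟩
      have hsi : s i = T.label v := by
        simp only [s, dif_pos hex]
        rw [hT.eq_of_level_eq hex.choose_spec.1 hv hex.choose_spec.2 hvi]
      rw [prefixAt_of_parent hu, ih u (not_isLeaf_of_parent hu) hui,
        ← infixOf_append s (Nat.zero_le i) (Nat.le_succ i), infixOf_succ, hsi]
  refine ⟨s, fun i => ?_, fun v => ?_⟩
  · simp only [s]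
    split_ifs with h
    · obtain ⟨u, hu, -⟩ := exists_parent_of_level h.choose_spec.2
      exact hℓ _ (hroot hu)
    · simp
  · cases hp : T.parent v with
    | none =>
      exact ⟨0, (Nat.zero_le _).trans_lt (level_lt_card (T := T) v), [], by simp,
        by rw [prefixAt_root hp, infixOf_self]; rfl⟩
    | some u =>
      exact ⟨T.level u, level_lt_card u, T.label v, hℓ v (hroot hp),
        by rw [prefixAt_of_parent hp, hspine _ u (not_isLeaf_of_parent hp) rfl]⟩

end LTree

/-- There is a constant `c` such that for every labeled caterpillar
tree `T` with `n ≥ 1` edges whose edge labels are strings of length at most `ℓ` over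
a weighted alphabet `Γ`, there is a contracting SLP over `Γ` with at most `c·n`
variables and right-hand sides of length at most `c·ℓ` that defines all nonempty
prefixes in `T`. -/
theorem caterpillar_prefix_slp :
    ∃ c : ℕ,
      ∀ (Γ ν : Type) (instΓ : Fintype Γ) (instν : Fintype ν)
        (w : Γ → ℕ), (∀ a : Γ, 0 < w a) →
        ∀ (T : LTree ν Γ) (n ℓ : ℕ), 1 ≤ n →
          T.Caterpillar →
          Fintype.card ν = n + 1 →
          (∀ v : ν, v ≠ T.root → (T.label v).length ≤ ℓ) →
          ∃ (V : Type) (instV : Fintype V) (G : SLP V Γ),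
            Fintype.card V ≤ c * n ∧
            (∀ A : V, (G.rhs A).length ≤ c * ℓ) ∧
            G.Contracting w ∧
            (∀ v : ν, T.prefixAt v ≠ [] → G.defines (T.prefixAt v)) := by
  refine ⟨42, fun Γ ν _ _ w hw T n ℓ hn hT hcard hlabel => ?_⟩
  obtain ⟨s, hs, hspine⟩ := hT.exists_spine hlabel
  rcases Nat.eq_zero_or_pos ℓ with rfl | hℓ
  · refine ⟨Unit, inferInstance, ⟨fun _ => [], fun _ => 0, by simp, ()⟩, by simp; omega, by simp,
      by simp [SLP.Contracting], fun v hv => absurd ?_ hv⟩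
    obtain ⟨i, -, t, ht, e⟩ := hspine v
    rw [e, List.eq_nil_of_length_eq_zero (Nat.le_zero.1 ht), List.append_nil, infixOf,
      List.flatten_eq_nil_iff]
    intro x hx
    obtain ⟨i, -, rfl⟩ := List.mem_map.1 hx
    exact List.eq_nil_of_length_eq_zero (Nat.le_zero.1 (hs i))
  have hW : Monotone fun i => wstr w (infixOf s 0 i) := fun i j hij => by
    simp only [← infixOf_append s (Nat.zero_le i) hij, wstr_append]
    exact Nat.le_add_right _ _
  obtain ⟨I, hI, hgood, hpre⟩ := IntervalSLP.exists_good_prefixes hW hn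
  let f : I ⊕ ν → List Γ := Sum.elim (fun p => infixOf s p.1.1 p.1.2) T.prefixAt
  have hrhs : ∀ A, ∃ u : List ((I ⊕ ν) ⊕ Γ), (u.map (Sum.elim f fun a => [a])).flatten = f A ∧
      u.length ≤ 42 * ℓ ∧
      ∀ B, Sum.inl B ∈ u → 0 < wstr w (f B) ∧ 2 * wstr w (f B) ≤ wstr w (f A) := by
    rintro (⟨p, hp⟩ | v)
    · have hsteps := hgood p hp
      obtain ⟨u, hu, hlen, hA⟩ := exists_rhs_of_steps hw hℓ hs (f := f) Sum.inl (fun _ => rfl)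
        hsteps
      refine ⟨u, hu, by omega, fun B hB => ?_⟩
      have := wstr_infixOf s w (IntervalSLP.Part.steps_le hsteps)
      simp only [f, Sum.elim_inl] at *
      rw [this]
      exact hA B hB
    · obtain ⟨i, hi, t, ht, e⟩ := hspine v
      have hsteps := hgood _ (hpre i (by omega))
      obtain ⟨u, hu, hlen, hA⟩ := exists_rhs_of_steps hw hℓ hs (f := f) Sum.inl (fun _ => rfl)
        hsteps
      refine ⟨u ++ t.map Sum.inr, ?_, ?_, fun B hB => ?_⟩
      · rw [List.map_append, List.flatten_append, hu]
        simp [f, e, Function.comp_def, ← List.flatMap_def]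
      · rw [List.length_append, List.length_map]
        omega
      · have hB' : Sum.inl B ∈ u := by simpa using hB
        refine (hA B hB').imp_right fun h => h.trans ?_
        simp only [f, Sum.elim_inr, e, wstr_append]
        omega
  choose rhs hval hlen hcontr using hrhs
  let G : SLP (I ⊕ ν) Γ :=
    { rhs := rhs
      rank := fun A => wstr w (f A)
      rank_lt := fun A B hB => by
        have := hcontr A B hB
        omega
      start := Sum.inr T.root }
  have hG : ∀ A, G.val A = f A := G.val_eq_of_rhs f hval
  refine ⟨I ⊕ ν, inferInstance, G, ?_, hlen, fun A B hB => ?_, fun v _ => ⟨Sum.inr v, hG _⟩⟩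
  · rw [Fintype.card_sum, Fintype.card_coe, hcard]
    omega
  · simp only [SLP.wval, hG]
    exact (hcontr A B hB).2
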